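/- arXiv:1203.5300 — 3 statements merged into one kernel-verified Lean document; each statement's English description precedes it below -/
import Mathlib

section
/- Let A, B ∈ M_n be Hermitian with spectra in an interval J, f : J → ℝ convex, and Φ : M_n → M_m a unital positive linear map. Then the eigenvalues of f((Φ(A)+Φ(B))/2) are weakly majorized by the eigenvalues of Φ(∫_0^1 f(tA+(1-t)B) dt), i.e., for every 1 ≤ k ≤ m, ∑_{j=1}^k λ_j(f((Φ(A)+Φ(B))/2)) ≤ ∑_{j=1}^k λ_j(Φ(∫_0^1 f(tA+(1-t)B) dt)). -/
open scoped ComplexOrder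

/-- The `j`-th largest eigenvalue (counted with multiplicity) of a Hermitian matrix. -/
noncomputable def eigDesc {n : ℕ} {A : Matrix (Fin n) (Fin n) ℂ}
    (hA : A.IsHermitian) (j : Fin n) : ℝ :=
  hA.eigenvalues (Tuple.sort hA.eigenvalues j.rev)

theorem sum_mul_le_sum_castLE_of_antitone {m k : ℕ} (hk : k ≤ m) {μ p : Fin m → ℝ}
    (hμ : Antitone μ) (hp0 : ∀ i, 0 ≤ p i) (hp1 : ∀ i, p i ≤ 1) (hp : ∑ i, p i = k) :
    ∑ i, p i * μ i ≤ ∑ j : Fin k, μ (Fin.castLE hk j) := by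
  obtain rfl | hk0 := Nat.eq_zero_or_pos k
  · have h0 : ∀ i, p i = 0 := by
      simpa [Finset.sum_eq_zero_iff_of_nonneg (fun i _ => hp0 i)] using hp
    simp [h0]
  set ν := μ ⟨k - 1, by omega⟩
  have hsum : ∀ g : Fin m → ℝ, ∑ j : Fin k, g (Fin.castLE hk j) =
      ∑ i : Fin m, if (i : ℕ) < k then g i else 0 := by
    intro g
    rw [← Finset.sum_filter]
    refine Finset.sum_bij (fun j _ => Fin.castLE hk j) (by simp) ?_ ?_ (by simp)
    · intro a _ b _ h
      exact Fin.castLE_injective hk h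
    · intro i hi
      exact ⟨⟨i, by simpa using hi⟩, by simp, rfl⟩
  have hle : ∑ i, p i * (μ i - ν) ≤ ∑ j : Fin k, (μ (Fin.castLE hk j) - ν) := by
    rw [hsum fun i => μ i - ν]
    refine Finset.sum_le_sum fun i _ => ?_
    split_ifs with hi
    · exact mul_le_of_le_one_left
        (sub_nonneg.2 <| hμ <| Fin.le_def.2 <| Nat.le_sub_one_of_lt hi) (hp1 i)
    · exact mul_nonpos_of_nonneg_of_nonpos (hp0 i)
        (sub_nonpos.2 <| hμ <| Fin.le_def.2 <| show k - 1 ≤ (i : ℕ) by omega)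
  simp only [mul_sub, Finset.sum_sub_distrib, ← Finset.sum_mul, hp, Finset.sum_const,
    Finset.card_univ, Fintype.card_fin, nsmul_eq_mul] at hle
  linarith

theorem Matrix.IsHermitian.toEuclideanLin_eigenvectorBasis {m : ℕ}
    {Y : Matrix (Fin m) (Fin m) ℂ} (hY : Y.IsHermitian) (j : Fin m) :
    Y.toEuclideanLin (hY.eigenvectorBasis j) =
      (hY.eigenvalues j : ℂ) • hY.eigenvectorBasis j := by
  ext i
  simpa [Matrix.toEuclideanLin] using congrFun (hY.mulVec_eigenvectorBasis j) i

theorem Matrix.IsHermitian.re_inner_toEuclideanLin {m : ℕ} {Y : Matrix (Fin m) (Fin m) ℂ}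
    (hY : Y.IsHermitian) (v : EuclideanSpace ℂ (Fin m)) :
    (inner ℂ v (Y.toEuclideanLin v)).re =
      ∑ j, ‖inner ℂ (hY.eigenvectorBasis j) v‖ ^ 2 * hY.eigenvalues j := by
  rw [← hY.eigenvectorBasis.sum_inner_mul_inner, Complex.re_sum]
  refine Finset.sum_congr rfl fun j _ => ?_
  rw [← (Matrix.isSymmetric_toEuclideanLin_iff.2 hY) _ _,
    hY.toEuclideanLin_eigenvectorBasis, inner_smul_left,
    ← inner_conj_symm v, Complex.conj_ofReal, mul_left_comm, Complex.conj_mul', mul_comm]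
  norm_cast

theorem eigDesc_antitone {m : ℕ} {Y : Matrix (Fin m) (Fin m) ℂ} (hY : Y.IsHermitian) :
    Antitone (eigDesc hY) := fun _ _ h =>
  Tuple.monotone_sort hY.eigenvalues (Fin.rev_le_rev.2 h)

theorem sum_re_inner_le_sum_eigDesc {m k : ℕ} (hk : k ≤ m) {Y : Matrix (Fin m) (Fin m) ℂ}
    (hY : Y.IsHermitian) {v : Fin k → EuclideanSpace ℂ (Fin m)} (hv : Orthonormal ℂ v) :
    ∑ i, (inner ℂ (v i) (Y.toEuclideanLin (v i))).re ≤
      ∑ j : Fin k, eigDesc hY (Fin.castLE hk j) := by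
  set w := hY.eigenvectorBasis
  set e : Fin m ≃ Fin m := Fin.revPerm.trans (Tuple.sort hY.eigenvalues)
  calc ∑ i, (inner ℂ (v i) (Y.toEuclideanLin (v i))).re
      = ∑ j, (∑ i, ‖inner ℂ (w (e j)) (v i)‖ ^ 2) * eigDesc hY j := by
        simp_rw [hY.re_inner_toEuclideanLin, Finset.sum_mul]
        rw [Finset.sum_comm]
        exact (Equiv.sum_comp e fun j => ∑ i, ‖inner ℂ (w j) (v i)‖ ^ 2 * hY.eigenvalues j).symm
    _ ≤ _ := by
        refine sum_mul_le_sum_castLE_of_antitone hk (eigDesc_antitone hY)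
          (fun j => by positivity) (fun j => ?_) ?_
        · simp_rw [norm_inner_symm (w (e j))]
          simpa using hv.sum_inner_products_le (w (e j)) (s := Finset.univ)
        · rw [Equiv.sum_comp e fun j => ∑ i, ‖inner ℂ (w j) (v i)‖ ^ 2, Finset.sum_comm]
          simp [w.sum_sq_norm_inner_right, hv.1]

theorem exists_perm_eq_comp_of_map_univ_eq {ι α : Type*} [Fintype ι] {g h : ι → α}
    (H : Finset.univ.val.map g = Finset.univ.val.map h) : ∃ σ : Equiv.Perm ι, g = h ∘ σ := by
  classical
  have e : ∀ c, {i // g i = c} ≃ {i // h i = c} := fun c => Fintype.equivOfCardEq <| by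
    have hc := congrArg (Multiset.count c) H
    simp only [Multiset.count_map] at hc
    simpa [Fintype.card_subtype, Finset.card_def, eq_comm] using hc
  exact ⟨Equiv.ofFiberEquiv e, funext fun i => (Equiv.ofFiberEquiv_map e i).symm⟩

theorem exists_perm_eigenvalues_cfc {m : ℕ} {C : Matrix (Fin m) (Fin m) ℂ} (hC : C.IsHermitian)
    {f : ℝ → ℝ} (hX : (cfc f C).IsHermitian) :
    ∃ σ : Equiv.Perm (Fin m), hX.eigenvalues = (f ∘ hC.eigenvalues) ∘ σ := by
  have h := hX.roots_charpoly_eq_eigenvalues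
  rw [hC.charpoly_cfc_eq, Polynomial.roots_prod _ _
    (Finset.prod_ne_zero_iff.2 fun i _ => Polynomial.X_sub_C_ne_zero _)] at h
  simp only [Polynomial.roots_X_sub_C, Multiset.bind_singleton] at h
  have h2 := congrArg (Multiset.map Complex.re) h
  simp only [Multiset.map_map, Function.comp_def] at h2
  obtain ⟨σ, hσ⟩ := exists_perm_eq_comp_of_map_univ_eq h2.symm
  exact ⟨σ, by simpa [Function.comp_def] using hσ⟩

section LoewnerOrder

open scoped MatrixOrder Matrix.Norms.L2Operator

variable {n m : ℕ}

theorem spectrum_subset_Icc_iff {A : Matrix (Fin n) (Fin n) ℂ} (hA : IsSelfAdjoint A) {a b : ℝ} :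
    spectrum ℝ A ⊆ Set.Icc a b ↔ a • 1 ≤ A ∧ A ≤ b • 1 := by
  rw [← Algebra.algebraMap_eq_smul_one, ← Algebra.algebraMap_eq_smul_one,
    algebraMap_le_iff_le_spectrum, le_algebraMap_iff_spectrum_le]
  exact ⟨fun h => ⟨fun x hx => (h hx).1, fun x hx => (h hx).2⟩, fun h x hx => ⟨h.1 x hx, h.2 x hx⟩⟩

theorem affine_le_cfc {A : Matrix (Fin n) (Fin n) ℂ} (hA : IsSelfAdjoint A) {f : ℝ → ℝ} {c d : ℝ}
    (h : ∀ x ∈ spectrum ℝ A, c * x + d ≤ f x) : c • A + d • 1 ≤ cfc f A := by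
  have hf : ContinuousOn f (spectrum ℝ A) := Matrix.finite_real_spectrum.continuousOn f
  have : c • A + d • 1 = cfc (fun x : ℝ => c * x + d) A := by
    rw [cfc_add_const (R := ℝ) d (fun x => c * x) A, cfc_const_mul c (fun x => x) A,
      cfc_id' ℝ A, Algebra.algebraMap_eq_smul_one]
  rw [this]
  exact cfc_mono h

theorem continuousOn_cfc_segment {A B : Matrix (Fin n) (Fin n) ℂ} {f : ℝ → ℝ} {a b : ℝ}
    (hs : ∀ t ∈ Set.Icc (0 : ℝ) 1, spectrum ℝ (t • A + (1 - t) • B) ⊆ Set.Icc a b)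
    (hA : IsSelfAdjoint A) (hB : IsSelfAdjoint B)
    (hf : ContinuousOn f (Set.Icc a b)) :
    ContinuousOn (fun t : ℝ => cfc f (t • A + (1 - t) • B)) (Set.Icc 0 1) := by
  refine ContinuousOn.cfc' (s := Set.Icc a b) isCompact_Icc f (by fun_prop) hs (fun t _ => ?_) hf
  exact ((IsSelfAdjoint.all t).smul hA).add ((IsSelfAdjoint.all (1 - t)).smul hB)

theorem of_integral_apply {G : ℝ → Matrix (Fin n) (Fin n) ℂ}
    (hG : IntervalIntegrable G MeasureTheory.volume 0 1) :
    (Matrix.of fun i j => ∫ t in (0:ℝ)..1, G t i j) = ∫ t in (0:ℝ)..1, G t := by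
  ext i j
  exact ((Matrix.entryLinearMap ℝ ℂ i j).toContinuousLinearMap).intervalIntegral_comp_comm hG

theorem integral_segment_affine (A B : Matrix (Fin n) (Fin n) ℂ) (c d : ℝ) :
    ∫ t in (0:ℝ)..1, (c • (t • A + (1 - t) • B) + d • (1 : Matrix (Fin n) (Fin n) ℂ)) =
      c • ((1 / 2 : ℝ) • (A + B)) + d • 1 := by
  rw [intervalIntegral.integral_add, intervalIntegral.integral_smul, intervalIntegral.integral_add,
    intervalIntegral.integral_smul_const, intervalIntegral.integral_smul_const]
  · have h : ∫ t in (0:ℝ)..1, 1 - t = 1 / 2 := by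
      rw [intervalIntegral.integral_sub (by simp) (by simp)]
      norm_num
    simp [h, smul_add]
  all_goals exact Continuous.intervalIntegrable (by fun_prop) _ _

theorem affine_le_integral_cfc {A B : Matrix (Fin n) (Fin n) ℂ} {f : ℝ → ℝ} {a b c d : ℝ}
    (hA : IsSelfAdjoint A) (hB : IsSelfAdjoint B)
    (hs : ∀ t ∈ Set.Icc (0 : ℝ) 1, spectrum ℝ (t • A + (1 - t) • B) ⊆ Set.Icc a b)
    (hf : ContinuousOn f (Set.Icc a b)) (hcd : ∀ x ∈ Set.Icc a b, c * x + d ≤ f x) :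
    c • ((1 / 2 : ℝ) • (A + B)) + d • 1 ≤
      Matrix.of fun i j => ∫ t in (0:ℝ)..1, (cfc f (t • A + (1 - t) • B)) i j := by
  have hG := (continuousOn_cfc_segment hs hA hB hf).intervalIntegrable_of_Icc
    (μ := MeasureTheory.volume) zero_le_one
  rw [of_integral_apply hG, ← integral_segment_affine, intervalIntegral.integral_of_le zero_le_one,
    intervalIntegral.integral_of_le zero_le_one]
  refine MeasureTheory.integral_mono_ae ?_ ((intervalIntegrable_iff_integrableOn_Ioc_of_le
    zero_le_one).1 hG) ?_
  · exact (intervalIntegrable_iff_integrableOn_Ioc_of_le zero_le_one).1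
      (Continuous.intervalIntegrable (by fun_prop) _ _)
  · filter_upwards [MeasureTheory.ae_restrict_mem measurableSet_Ioc] with t ht
    have ht' := Set.Ioc_subset_Icc_self ht
    exact affine_le_cfc (((IsSelfAdjoint.all t).smul hA).add ((IsSelfAdjoint.all (1 - t)).smul hB))
      fun x hx => hcd x (hs t ht' hx)

theorem spectrum_segment_subset_Icc {A B : Matrix (Fin n) (Fin n) ℂ} {a b t : ℝ}
    (hA : IsSelfAdjoint A) (hB : IsSelfAdjoint B) (hsA : spectrum ℝ A ⊆ Set.Icc a b)
    (hsB : spectrum ℝ B ⊆ Set.Icc a b) (ht : t ∈ Set.Icc (0 : ℝ) 1) :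
    spectrum ℝ (t • A + (1 - t) • B) ⊆ Set.Icc a b := by
  rw [spectrum_subset_Icc_iff hA] at hsA
  rw [spectrum_subset_Icc_iff hB] at hsB
  rw [spectrum_subset_Icc_iff
    (((IsSelfAdjoint.all t).smul hA).add ((IsSelfAdjoint.all (1 - t)).smul hB))]
  exact convex_Icc (𝕜 := ℝ) (a • 1 : Matrix (Fin n) (Fin n) ℂ) (b • 1) hsA hsB ht.1
    (sub_nonneg.2 ht.2) (add_sub_cancel _ _)

theorem monotone_of_map_posSemidef
    {Φ : Matrix (Fin n) (Fin n) ℂ →ₗ[ℂ] Matrix (Fin m) (Fin m) ℂ}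
    (hpos : ∀ X : Matrix (Fin n) (Fin n) ℂ, X.PosSemidef → (Φ X).PosSemidef) :
    Monotone Φ := fun X Y h => by
  rw [Matrix.le_iff] at h ⊢
  rw [← map_sub]
  exact hpos _ h

theorem map_real_smul_one {Φ : Matrix (Fin n) (Fin n) ℂ →ₗ[ℂ] Matrix (Fin m) (Fin m) ℂ}
    (hunital : Φ 1 = 1) (r : ℝ) : Φ (r • 1) = r • 1 := by
  rw [LinearMap.map_smul_of_tower, hunital]

theorem map_mem_Icc_smul_one
    {Φ : Matrix (Fin n) (Fin n) ℂ →ₗ[ℂ] Matrix (Fin m) (Fin m) ℂ}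
    (hpos : ∀ X : Matrix (Fin n) (Fin n) ℂ, X.PosSemidef → (Φ X).PosSemidef)
    (hunital : Φ 1 = 1) {X : Matrix (Fin n) (Fin n) ℂ} {a b : ℝ}
    (hX : a • 1 ≤ X ∧ X ≤ b • 1) : a • 1 ≤ Φ X ∧ Φ X ≤ b • 1 := by
  rw [← map_real_smul_one hunital a, ← map_real_smul_one hunital b]
  exact ⟨monotone_of_map_posSemidef hpos hX.1, monotone_of_map_posSemidef hpos hX.2⟩

theorem isSelfAdjoint_of_smul_one_le {X : Matrix (Fin n) (Fin n) ℂ} {a : ℝ} (h : a • 1 ≤ X) :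
    IsSelfAdjoint X := by
  have h1 : IsSelfAdjoint (X - a • 1) := (sub_nonneg.2 h).isSelfAdjoint
  simpa using h1.add ((IsSelfAdjoint.all a).smul (IsSelfAdjoint.one _))

theorem affine_eigenvalue_le_re_inner {C Y : Matrix (Fin m) (Fin m) ℂ} (hC : C.IsHermitian)
    {c d : ℝ} (h : c • C + d • 1 ≤ Y) (i : Fin m) :
    c * hC.eigenvalues i + d ≤ (inner ℂ (hC.eigenvectorBasis i)
      (Y.toEuclideanLin (hC.eigenvectorBasis i))).re := by
  set u := hC.eigenvectorBasis i
  have hnn : 0 ≤ (inner ℂ u ((Y - (c • C + d • 1)).toEuclideanLin u)).re := by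
    have := (Matrix.le_iff.1 h).re_dotProduct_nonneg u.ofLp
    simpa [-map_sub, -map_add, EuclideanSpace.inner_eq_star_dotProduct, Matrix.toEuclideanLin,
      dotProduct_comm] using this
  have hu : C.toEuclideanLin u = (hC.eigenvalues i : ℂ) • u :=
    hC.toEuclideanLin_eigenvectorBasis i
  have h1 : (c • C + d • 1).toEuclideanLin u = ((c * hC.eigenvalues i + d : ℝ) : ℂ) • u := by
    have : (c • C + d • 1) = (c : ℂ) • C + (d : ℂ) • (1 : Matrix (Fin m) (Fin m) ℂ) := by
      simp [Complex.coe_smul]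
    rw [this, map_add, map_smul, map_smul, LinearMap.add_apply, LinearMap.smul_apply,
      LinearMap.smul_apply, hu, smul_smul, Matrix.toEuclideanLin, Matrix.toLpLin_one]
    simp [add_smul]
  have hun : ‖u‖ = 1 := hC.eigenvectorBasis.orthonormal.1 i
  rw [map_sub, LinearMap.sub_apply, h1, inner_sub_right, inner_smul_right,
    inner_self_eq_norm_sq_to_K, hun, Complex.sub_re] at hnn
  simpa using hnn

end LoewnerOrder

/-- Matrix Hermite–Hadamard, first inequality: the eigenvalues of
`f((Φ(A)+Φ(B))/2)` are weakly majorized by those of `Φ(∫_0^1 f(tA+(1-t)B) dt)`,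
for `A, B` Hermitian with spectra in `J`, `f` convex (and continuous) on `J` and
`Φ` a unital positive linear map. The integral is taken entrywise. -/
theorem weak_majorization_hermite_hadamard
    {n m : ℕ} (A B : Matrix (Fin n) (Fin n) ℂ)
    (hA : A.IsHermitian) (hB : B.IsHermitian)
    (J : Set ℝ) (hJA : spectrum ℝ A ⊆ J) (hJB : spectrum ℝ B ⊆ J)
    (f : ℝ → ℝ) (hconv : ConvexOn ℝ J f) (hcont : ContinuousOn f J)
    (Φ : Matrix (Fin n) (Fin n) ℂ →ₗ[ℂ] Matrix (Fin m) (Fin m) ℂ)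
    (hpos : ∀ X : Matrix (Fin n) (Fin n) ℂ, X.PosSemidef → (Φ X).PosSemidef)
    (hunital : Φ 1 = 1)
    (hX : (cfc f ((1/2 : ℝ) • (Φ A + Φ B))).IsHermitian)
    (hY : (Φ (Matrix.of fun i j =>
        ∫ t in (0:ℝ)..1, (cfc f (t • A + (1 - t) • B)) i j)).IsHermitian)
    (k : ℕ) (hk1 : 1 ≤ k) (hk : k ≤ m) :
    ∑ j : Fin k, eigDesc hX (Fin.castLE hk j) ≤
      ∑ j : Fin k, eigDesc hY (Fin.castLE hk j) := by
  rcases Nat.eq_zero_or_pos n with rfl | hn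
  · have h1 : (1 : Matrix (Fin m) (Fin m) ℂ) = 0 := by
      rw [← hunital, Subsingleton.elim (1 : Matrix (Fin 0) (Fin 0) ℂ) 0, map_zero]
    have := congrFun₂ h1 ⟨0, by omega⟩ ⟨0, by omega⟩
    simp at this
  obtain ⟨a, b, hab, hsA, hsB⟩ : ∃ a b : ℝ, Set.Icc a b ⊆ J ∧ spectrum ℝ A ⊆ Set.Icc a b ∧
      spectrum ℝ B ⊆ Set.Icc a b := by
    have hfin : (spectrum ℝ A ∪ spectrum ℝ B).Finite :=
      Matrix.finite_real_spectrum.union Matrix.finite_real_spectrum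
    have hne : (spectrum ℝ A ∪ spectrum ℝ B).Nonempty :=
      ⟨_, .inl (hA.eigenvalues_mem_spectrum_real ⟨0, hn⟩)⟩
    have hsub := Set.union_subset hJA hJB
    have hIcc : spectrum ℝ A ∪ spectrum ℝ B ⊆ Set.Icc (sInf (spectrum ℝ A ∪ spectrum ℝ B))
      (sSup (spectrum ℝ A ∪ spectrum ℝ B)) := fun x hx =>
        ⟨csInf_le hfin.bddBelow hx, le_csSup hfin.bddAbove hx⟩
    exact ⟨_, _, hconv.1.ordConnected.out (hsub (hne.csInf_mem hfin))
      (hsub (hne.csSup_mem hfin)), Set.union_subset_iff.1 hIcc⟩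
  have hf := hcont.mono hab
  have hs : ∀ t ∈ Set.Icc (0 : ℝ) 1, spectrum ℝ (t • A + (1 - t) • B) ⊆ Set.Icc a b :=
    fun t ht => spectrum_segment_subset_Icc hA hB hsA hsB ht
  have hΦM : Φ ((1 / 2 : ℝ) • (A + B)) = (1 / 2 : ℝ) • (Φ A + Φ B) := by
    rw [LinearMap.map_smul_of_tower, map_add]
  obtain ⟨hC, hsC⟩ : ((1 / 2 : ℝ) • (Φ A + Φ B)).IsHermitian ∧
      spectrum ℝ ((1 / 2 : ℝ) • (Φ A + Φ B)) ⊆ Set.Icc a b := by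
    have hM := hs (1 / 2) (by norm_num)
    rw [show (1 / 2 : ℝ) • A + (1 - 1 / 2 : ℝ) • B = (1 / 2 : ℝ) • (A + B) by
      rw [smul_add]; norm_num] at hM
    have hM' := map_mem_Icc_smul_one hpos hunital ((spectrum_subset_Icc_iff
      ((IsSelfAdjoint.all (1 / 2 : ℝ)).smul (hA.add hB))).1 hM)
    rw [hΦM] at hM'
    have hC := isSelfAdjoint_of_smul_one_le hM'.1
    exact ⟨hC, (spectrum_subset_Icc_iff hC).2 hM'⟩
  have key : ∀ i, f (hC.eigenvalues i) ≤ (inner ℂ (hC.eigenvectorBasis i)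
      ((Φ (Matrix.of fun i j => ∫ t in (0:ℝ)..1,
        (cfc f (t • A + (1 - t) • B)) i j)).toEuclideanLin (hC.eigenvectorBasis i))).re := by
    refine fun i => le_of_forall_lt fun r hr => ?_
    obtain ⟨r', hrr', hr'⟩ := exists_between hr
    obtain ⟨c, d, hcd, hr⟩ := ConvexOn.exists_affine_le_of_lt_real
      (hsC (hC.eigenvalues_mem_spectrum_real i)) hr' isClosed_Icc hf.lowerSemicontinuousOn
      (hconv.subset hab (convex_Icc a b))
    have hle := monotone_of_map_posSemidef hpos (affine_le_integral_cfc hA hB hs hf hcd)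
    rw [map_add, map_real_smul_one hunital, LinearMap.map_smul_of_tower, hΦM] at hle
    exact hrr'.trans_le (hr.symm.trans_le (affine_eigenvalue_le_re_inner hC hle i))
  obtain ⟨σ, hσ⟩ := exists_perm_eigenvalues_cfc hC hX
  set g : Fin k → Fin m := fun j => σ (Tuple.sort hX.eigenvalues (Fin.castLE hk j).rev)
  have hg : Function.Injective g := σ.injective.comp <| (Equiv.injective _).comp <|
    Fin.rev_injective.comp <| Fin.castLE_injective hk
  refine le_trans (Finset.sum_le_sum fun j _ => ?_)
    (sum_re_inner_le_sum_eigDesc hk hY (hC.eigenvectorBasis.orthonormal.comp g hg))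
  exact (congrFun hσ _).trans_le (key (g j))
end

section
/- Let A, B ∈ M_n be Hermitian with spectra in [ω, Ω] and f convex on [ω, Ω]. Then for every 1 ≤ k ≤ n, ∑_{j=1}^k λ_j(f((A+B)/2)) ≤ ∑_{j=1}^k λ_j(∫_0^1 f(tA+(1-t)B) dt), i.e., the eigenvalues of f((A+B)/2) are weakly majorized by those of ∫_0^1 f(tA+(1-t)B) dt. -/
section

open Matrix WithLp

variable {n : ℕ}

/-- The real part of the quadratic form of a complex matrix. -/
noncomputable def reQuadForm (M : Matrix (Fin n) (Fin n) ℂ)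
    (x : EuclideanSpace ℂ (Fin n)) : ℝ :=
  (inner ℂ x (toEuclideanCLM (𝕜 := ℂ) M x)).re

lemma sum_sq_norm_inner_basis_eq_one (b : OrthonormalBasis (Fin n) ℂ (EuclideanSpace ℂ (Fin n)))
    {x : EuclideanSpace ℂ (Fin n)} (hx : ‖x‖ = 1) : ∑ i, ‖inner ℂ (b i) x‖ ^ 2 = 1 := by
  rw [b.sum_sq_norm_inner_right, hx, one_pow]

lemma reQuadForm_eq_sum_of_eigenbasis {M : Matrix (Fin n) (Fin n) ℂ}
    (b : OrthonormalBasis (Fin n) ℂ (EuclideanSpace ℂ (Fin n))) (r : Fin n → ℝ)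
    (h : ∀ i, M *ᵥ ofLp (b i) = r i • ofLp (b i)) (x : EuclideanSpace ℂ (Fin n)) :
    reQuadForm M x = ∑ i, r i * ‖inner ℂ (b i) x‖ ^ 2 := by
  have hb : ∀ i, toEuclideanCLM (𝕜 := ℂ) M (b i) = (r i : ℂ) • b i := fun i => by
    ext j
    simpa using congrFun (h i) j
  have hx : toEuclideanCLM (𝕜 := ℂ) M x = ∑ i, inner ℂ (b i) x • (r i : ℂ) • b i := by
    conv_lhs => rw [← b.sum_repr' x]
    simp only [map_sum, map_smul, hb]
  rw [reQuadForm, hx, inner_sum, Complex.re_sum]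
  refine Finset.sum_congr rfl fun i _ => ?_
  rw [inner_smul_right, inner_smul_right, mul_left_comm, ← inner_conj_symm x (b i),
    RCLike.mul_conj]
  simp [← Complex.ofReal_pow]

lemma Matrix.IsHermitian.reQuadForm_eq_sum {M : Matrix (Fin n) (Fin n) ℂ} (hM : M.IsHermitian)
    (x : EuclideanSpace ℂ (Fin n)) :
    reQuadForm M x = ∑ i, hM.eigenvalues i * ‖inner ℂ (hM.eigenvectorBasis i) x‖ ^ 2 :=
  reQuadForm_eq_sum_of_eigenbasis _ _ hM.mulVec_eigenvectorBasis x

lemma Matrix.IsHermitian.reQuadForm_cfc_eq_sum {M : Matrix (Fin n) (Fin n) ℂ}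
    (hM : M.IsHermitian) (f : ℝ → ℝ) (x : EuclideanSpace ℂ (Fin n)) :
    reQuadForm (cfc f M) x =
      ∑ i, f (hM.eigenvalues i) * ‖inner ℂ (hM.eigenvectorBasis i) x‖ ^ 2 := by
  refine reQuadForm_eq_sum_of_eigenbasis _ _ (fun i => ?_) x
  rw [hM.cfc_eq, IsHermitian.cfc, Unitary.conjStarAlgAut_apply, ← mulVec_mulVec,
    hM.star_eigenvectorUnitary_mulVec, ← mulVec_mulVec, diagonal_mulVec_single,
    ← hM.eigenvectorUnitary_mulVec i, mulVec_single]
  ext j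
  simp [mul_comm]

lemma Matrix.IsHermitian.reQuadForm_eigenvectorBasis {M : Matrix (Fin n) (Fin n) ℂ}
    (hM : M.IsHermitian) (i : Fin n) :
    reQuadForm M (hM.eigenvectorBasis i) = hM.eigenvalues i := by
  rw [hM.reQuadForm_eq_sum, Finset.sum_eq_single i]
  · simp
  · intro j _ hj
    simp [hM.eigenvectorBasis.inner_eq_zero hj]
  · simp

lemma Matrix.IsHermitian.reQuadForm_mem_Icc {M : Matrix (Fin n) (Fin n) ℂ} (hM : M.IsHermitian)
    {a b : ℝ} (h : spectrum ℝ M ⊆ Set.Icc a b) {x : EuclideanSpace ℂ (Fin n)} (hx : ‖x‖ = 1) :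
    reQuadForm M x ∈ Set.Icc a b := by
  rw [hM.reQuadForm_eq_sum]
  simp_rw [mul_comm (hM.eigenvalues _), ← smul_eq_mul]
  exact (convex_Icc a b).sum_mem (fun _ _ => sq_nonneg _)
    (sum_sq_norm_inner_basis_eq_one _ hx) fun i _ => h (hM.eigenvalues_mem_spectrum_real i)

/-- Jensen's inequality for the functional calculus of a Hermitian matrix. -/
lemma Matrix.IsHermitian.map_reQuadForm_le {M : Matrix (Fin n) (Fin n) ℂ} (hM : M.IsHermitian)
    {s : Set ℝ} (h : spectrum ℝ M ⊆ s) {f : ℝ → ℝ} (hf : ConvexOn ℝ s f)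
    {x : EuclideanSpace ℂ (Fin n)} (hx : ‖x‖ = 1) :
    f (reQuadForm M x) ≤ reQuadForm (cfc f M) x := by
  rw [hM.reQuadForm_eq_sum, hM.reQuadForm_cfc_eq_sum]
  simp_rw [mul_comm _ (‖_‖ ^ 2), ← smul_eq_mul]
  exact hf.map_sum_le (fun _ _ => sq_nonneg _)
    (sum_sq_norm_inner_basis_eq_one _ hx) fun i _ => h (hM.eigenvalues_mem_spectrum_real i)

lemma reQuadForm_add (M N : Matrix (Fin n) (Fin n) ℂ) (x : EuclideanSpace ℂ (Fin n)) :
    reQuadForm (M + N) x = reQuadForm M x + reQuadForm N x := by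
  simp [reQuadForm]

lemma reQuadForm_smul (r : ℝ) (M : Matrix (Fin n) (Fin n) ℂ) (x : EuclideanSpace ℂ (Fin n)) :
    reQuadForm (r • M) x = r * reQuadForm M x := by
  have : r • M = (r : ℂ) • M := by ext; simp
  rw [reQuadForm, this, map_smul, _root_.smul_apply, inner_smul_right,
    Complex.re_ofReal_mul, reQuadForm]

lemma reQuadForm_eq_sum_apply (M : Matrix (Fin n) (Fin n) ℂ) (x : EuclideanSpace ℂ (Fin n)) :
    reQuadForm M x = (∑ i, ∑ j, M i j * (x j * star (x i))).re := by
  simp only [reQuadForm, EuclideanSpace.inner_eq_star_dotProduct, ofLp_toEuclideanCLM, dotProduct,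
    mulVec, Finset.sum_mul, mul_assoc, Pi.star_apply]

lemma continuous_reQuadForm (x : EuclideanSpace ℂ (Fin n)) :
    Continuous fun M : Matrix (Fin n) (Fin n) ℂ => reQuadForm M x := by
  simp only [reQuadForm_eq_sum_apply]
  fun_prop

lemma intervalIntegral_reQuadForm {F : ℝ → Matrix (Fin n) (Fin n) ℂ} {a b : ℝ}
    (hF : ContinuousOn F (Set.uIcc a b)) (x : EuclideanSpace ℂ (Fin n)) :
    reQuadForm (Matrix.of fun i j => ∫ t in a..b, F t i j) x =
      ∫ t in a..b, reQuadForm (F t) x := by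
  have hij : ∀ i j, ContinuousOn (fun t => F t i j) (Set.uIcc a b) := fun i j =>
    (continuous_apply_apply i j).comp_continuousOn hF
  simp only [reQuadForm_eq_sum_apply, of_apply]
  have hre : (∫ t in a..b, (∑ i, ∑ j, F t i j * (x j * star (x i))).re) =
      (∫ t in a..b, ∑ i, ∑ j, F t i j * (x j * star (x i))).re := by
    refine Complex.reCLM.intervalIntegral_comp_comm (ContinuousOn.intervalIntegrable ?_)
    fun_prop
  rw [hre, intervalIntegral.integral_finsetSum fun i _ => ContinuousOn.intervalIntegrable
    (by fun_prop)]
  congr 1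
  refine Finset.sum_congr rfl fun i _ => ?_
  rw [intervalIntegral.integral_finsetSum fun j _ => ContinuousOn.intervalIntegrable
    (by fun_prop)]
  simp only [intervalIntegral.integral_mul_const]

open scoped Matrix.Norms.L2Operator in
lemma continuousOn_matrix_cfc {X : Type*} [TopologicalSpace X] {s : Set ℝ} (hs : IsCompact s)
    {f : ℝ → ℝ} (hf : ContinuousOn f s) {C : X → Matrix (Fin n) (Fin n) ℂ} {T : Set X}
    (hC : ContinuousOn C T) (hherm : ∀ t ∈ T, (C t).IsHermitian)
    (hspec : ∀ t ∈ T, spectrum ℝ (C t) ⊆ s) :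
    ContinuousOn (fun t => cfc f (C t)) T :=
  (continuousOn_cfc (p := IsSelfAdjoint) (Matrix (Fin n) (Fin n) ℂ) hs f hf).comp hC
    fun t ht => ⟨hherm t ht, hspec t ht⟩

lemma Matrix.IsHermitian.spectrum_segment_subset {A B : Matrix (Fin n) (Fin n) ℂ}
    (hA : A.IsHermitian) (hB : B.IsHermitian) {a b : ℝ} (hJA : spectrum ℝ A ⊆ Set.Icc a b)
    (hJB : spectrum ℝ B ⊆ Set.Icc a b) {s t : ℝ} (hs : 0 ≤ s) (ht : 0 ≤ t) (hst : s + t = 1)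
    (hC : (s • A + t • B).IsHermitian) : spectrum ℝ (s • A + t • B) ⊆ Set.Icc a b := by
  rw [hC.spectrum_real_eq_range_eigenvalues]
  rintro _ ⟨i, rfl⟩
  have hx : ‖hC.eigenvectorBasis i‖ = 1 := by simp
  rw [← hC.reQuadForm_eigenvectorBasis, reQuadForm_add, reQuadForm_smul, reQuadForm_smul]
  exact convex_Icc a b (hA.reQuadForm_mem_Icc hJA hx) (hB.reQuadForm_mem_Icc hJB hx) hs ht hst

lemma isHermitian_smul_add_smul {A B : Matrix (Fin n) (Fin n) ℂ}
    (hA : A.IsHermitian) (hB : B.IsHermitian) (s t : ℝ) : (s • A + t • B).IsHermitian :=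
  (IsSelfAdjoint.smul (.all s) hA).add (IsSelfAdjoint.smul (.all t) hB)

/-- The Hermite–Hadamard inequality, in the form `f ((a + b) / 2) ≤ ∫ f (t a + (1 - t) b)`. -/
lemma ConvexOn.map_midpoint_le_integral {a b ω Ω : ℝ} {f : ℝ → ℝ}
    (hf : ConvexOn ℝ (Set.Icc ω Ω) f) (hc : ContinuousOn f (Set.Icc ω Ω))
    (ha : a ∈ Set.Icc ω Ω) (hb : b ∈ Set.Icc ω Ω) :
    f ((a + b) / 2) ≤ ∫ t in (0 : ℝ)..1, f (t * a + (1 - t) * b) := by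
  have hmem : ∀ t ∈ Set.Icc (0 : ℝ) 1, t * a + (1 - t) * b ∈ Set.Icc ω Ω := fun t ht =>
    convex_Icc ω Ω ha hb ht.1 (by linarith [ht.2]) (by ring)
  have hcf : ContinuousOn (fun t : ℝ => f (t * a + (1 - t) * b)) (Set.uIcc 0 1) := by
    rw [Set.uIcc_of_le zero_le_one]
    exact hc.comp (by fun_prop) hmem
  have hcf' : ContinuousOn (fun t : ℝ => f ((1 - t) * a + t * b)) (Set.uIcc 0 1) := by
    rw [Set.uIcc_of_le zero_le_one]
    refine hc.comp (by fun_prop) fun t ht => ?_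
    convert hmem (1 - t) ⟨by linarith [ht.2], by linarith [ht.1]⟩ using 1
    ring
  have hrefl : ∫ t in (0 : ℝ)..1, f ((1 - t) * a + t * b) =
      ∫ t in (0 : ℝ)..1, f (t * a + (1 - t) * b) := by
    have := intervalIntegral.integral_comp_sub_left (a := 0) (b := 1)
      (fun t : ℝ => f (t * a + (1 - t) * b)) 1
    simpa using this
  have hle : ∫ _ in (0 : ℝ)..1, 2 * f ((a + b) / 2) ≤
      ∫ t in (0 : ℝ)..1, (f (t * a + (1 - t) * b) + f ((1 - t) * a + t * b)) := by
    refine intervalIntegral.integral_mono_on zero_le_one (by simp)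
      (hcf.add hcf').intervalIntegrable fun t ht => ?_
    have h₁ := hmem t ht
    have h₂ := hmem (1 - t) ⟨by linarith [ht.2], by linarith [ht.1]⟩
    have := hf.2 h₁ h₂ one_half_pos.le one_half_pos.le (add_halves (1 : ℝ))
    simp only [smul_eq_mul] at this
    rw [show 1 / 2 * (t * a + (1 - t) * b) + 1 / 2 * ((1 - t) * a + (1 - (1 - t)) * b)
      = (a + b) / 2 by ring, sub_sub_cancel] at this
    linarith
  rw [intervalIntegral.integral_add hcf.intervalIntegrable hcf'.intervalIntegrable, hrefl] at hle
  simp at hle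
  linarith

lemma map_reQuadForm_midpoint_le {A B : Matrix (Fin n) (Fin n) ℂ}
    (hA : A.IsHermitian) (hB : B.IsHermitian) {ω Ω : ℝ}
    (hJA : spectrum ℝ A ⊆ Set.Icc ω Ω) (hJB : spectrum ℝ B ⊆ Set.Icc ω Ω)
    {f : ℝ → ℝ} (hconv : ConvexOn ℝ (Set.Icc ω Ω) f) (hcont : ContinuousOn f (Set.Icc ω Ω))
    {x : EuclideanSpace ℂ (Fin n)} (hx : ‖x‖ = 1) :
    f (reQuadForm ((1 / 2 : ℝ) • (A + B)) x) ≤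
      reQuadForm (Matrix.of fun i j =>
        ∫ t in (0:ℝ)..1, (cfc f (t • A + (1 - t) • B)) i j) x := by
  have ha := hA.reQuadForm_mem_Icc hJA hx
  have hb := hB.reQuadForm_mem_Icc hJB hx
  have hherm : ∀ t : ℝ, (t • A + (1 - t) • B).IsHermitian := fun t =>
    isHermitian_smul_add_smul hA hB t (1 - t)
  have hspec : ∀ t ∈ Set.Icc (0 : ℝ) 1, spectrum ℝ (t • A + (1 - t) • B) ⊆ Set.Icc ω Ω :=
    fun t ht => hA.spectrum_segment_subset hB hJA hJB ht.1 (by linarith [ht.2]) (by ring) (hherm t)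
  have hF : ContinuousOn (fun t : ℝ => cfc f (t • A + (1 - t) • B)) (Set.uIcc 0 1) := by
    rw [Set.uIcc_of_le zero_le_one]
    exact continuousOn_matrix_cfc isCompact_Icc hcont (by fun_prop) (fun t _ => hherm t) hspec
  have hmid : reQuadForm ((1 / 2 : ℝ) • (A + B)) x = (reQuadForm A x + reQuadForm B x) / 2 := by
    rw [reQuadForm_smul, reQuadForm_add]; ring
  rw [intervalIntegral_reQuadForm hF, hmid]
  refine (hconv.map_midpoint_le_integral hcont ha hb).trans
    (intervalIntegral.integral_mono_on zero_le_one (ContinuousOn.intervalIntegrable ?_)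
      ((continuous_reQuadForm x).comp_continuousOn hF).intervalIntegrable fun t ht => ?_)
  · rw [Set.uIcc_of_le zero_le_one]
    exact hcont.comp (by fun_prop) fun t ht =>
      convex_Icc ω Ω ha hb ht.1 (by linarith [ht.2]) (by ring)
  · have := (hherm t).map_reQuadForm_le (hspec t ht) hconv hx
    rwa [reQuadForm_add, reQuadForm_smul, reQuadForm_smul] at this

lemma sum_mul_le_sum_castLE_of_antitone_s7 {a c : Fin n → ℝ} (ha : Antitone a)
    (hc0 : ∀ i, 0 ≤ c i) (hc1 : ∀ i, c i ≤ 1) {k : ℕ} (hk1 : 1 ≤ k) (hk : k ≤ n)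
    (hsum : ∑ i, c i = k) : ∑ i, a i * c i ≤ ∑ j : Fin k, a (Fin.castLE hk j) := by
  set τ := a ⟨k - 1, by omega⟩
  have hind : ∀ g : Fin n → ℝ,
      ∑ j : Fin k, g (Fin.castLE hk j) = ∑ i : Fin n, if (i : ℕ) < k then g i else 0 := by
    intro g
    rw [← Finset.sum_filter]
    refine Finset.sum_bij (fun j _ => Fin.castLE hk j) (by simp) (by simp) (fun i hi => ?_) (by simp)
    simp only [Finset.mem_filter, Finset.mem_univ, true_and] at hi
    exact ⟨⟨i, hi⟩, by simp, rfl⟩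
  have hcard : ∑ i : Fin n, (if (i : ℕ) < k then (1 : ℝ) else 0) = k := by
    rw [← hind fun _ => 1]; simp
  have key : ∑ i, (a i - τ) * c i ≤ ∑ i : Fin n, if (i : ℕ) < k then a i - τ else 0 := by
    refine Finset.sum_le_sum fun i _ => ?_
    split_ifs with h
    · have : τ ≤ a i := ha (Fin.mk_le_mk.2 (by omega) : i ≤ ⟨k - 1, _⟩)
      nlinarith [hc1 i]
    · have : a i ≤ τ := ha (Fin.mk_le_mk.2 (by omega) : (⟨k - 1, _⟩ : Fin n) ≤ i)
      nlinarith [hc0 i]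
  rw [← hind fun i => a i - τ] at key
  simp only [sub_mul, Finset.sum_sub_distrib, ← Finset.mul_sum, hsum, Finset.sum_const,
    Finset.card_univ, Fintype.card_fin, nsmul_eq_mul] at key
  linarith

/-- The permutation listing the eigenvalues in decreasing order. -/
noncomputable def eigDescPerm {M : Matrix (Fin n) (Fin n) ℂ} (hM : M.IsHermitian) :
    Equiv.Perm (Fin n) :=
  Fin.revPerm.trans (Tuple.sort hM.eigenvalues)

lemma eigDesc_eq {M : Matrix (Fin n) (Fin n) ℂ} (hM : M.IsHermitian) (j : Fin n) :
    eigDesc hM j = hM.eigenvalues (eigDescPerm hM j) := rfl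

lemma antitone_eigDesc {M : Matrix (Fin n) (Fin n) ℂ} (hM : M.IsHermitian) :
    Antitone (eigDesc hM) := fun _ _ hij =>
  Tuple.monotone_sort hM.eigenvalues (Fin.rev_le_rev.2 hij)

/-- **Ky Fan's maximum principle**, for weights in `[0, 1]` on the eigenvalues. -/
lemma sum_eigenvalues_mul_le_sum_eigDesc {M : Matrix (Fin n) (Fin n) ℂ} (hM : M.IsHermitian)
    {c : Fin n → ℝ} (hc0 : ∀ i, 0 ≤ c i) (hc1 : ∀ i, c i ≤ 1) {k : ℕ} (hk1 : 1 ≤ k) (hk : k ≤ n)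
    (hsum : ∑ i, c i = k) :
    ∑ i, hM.eigenvalues i * c i ≤ ∑ j : Fin k, eigDesc hM (Fin.castLE hk j) := by
  rw [← Equiv.sum_comp (eigDescPerm hM)]
  refine sum_mul_le_sum_castLE_of_antitone_s7 (antitone_eigDesc hM) (fun i => hc0 (eigDescPerm hM i))
    (fun i => hc1 _) hk1 hk ?_
  rw [← hsum, Equiv.sum_comp (eigDescPerm hM) c]

end

/-- For Hermitian `A, B` with spectra in `[ω, Ω]` and `f` convex (and continuous)
on `[ω, Ω]`, the eigenvalues of `f((A+B)/2)` are weakly majorized by those of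
`∫_0^1 f(tA+(1-t)B) dt` (taken entrywise). -/
theorem weak_majorization_hermite_hadamard_matrix
    {n : ℕ} (A B : Matrix (Fin n) (Fin n) ℂ)
    (hA : A.IsHermitian) (hB : B.IsHermitian) (ω Ω : ℝ)
    (hJA : spectrum ℝ A ⊆ Set.Icc ω Ω) (hJB : spectrum ℝ B ⊆ Set.Icc ω Ω)
    (f : ℝ → ℝ) (hconv : ConvexOn ℝ (Set.Icc ω Ω) f)
    (hcont : ContinuousOn f (Set.Icc ω Ω))
    (hX : (cfc f ((1/2 : ℝ) • (A + B))).IsHermitian)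
    (hY : (Matrix.of fun i j =>
        ∫ t in (0:ℝ)..1, (cfc f (t • A + (1 - t) • B)) i j : Matrix (Fin n) (Fin n) ℂ).IsHermitian)
    (k : ℕ) (hk1 : 1 ≤ k) (hk : k ≤ n) :
    ∑ j : Fin k, eigDesc hX (Fin.castLE hk j) ≤
      ∑ j : Fin k, eigDesc hY (Fin.castLE hk j) := by
  have hM : ((1 / 2 : ℝ) • (A + B)).IsHermitian := by
    rw [smul_add]; exact isHermitian_smul_add_smul hA hB _ _
  set u := hM.eigenvectorBasis
  set y := hY.eigenvectorBasis
  set x : Fin n → EuclideanSpace ℂ (Fin n) := fun j => hX.eigenvectorBasis (eigDescPerm hX j)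
  have hx : ∀ v : EuclideanSpace ℂ (Fin n), ‖v‖ = 1 → ∑ j, ‖inner ℂ v (x j)‖ ^ 2 = 1 := by
    intro v hv
    rw [Equiv.sum_comp (eigDescPerm hX) fun j => ‖inner ℂ v (hX.eigenvectorBasis j)‖ ^ 2,
      OrthonormalBasis.sum_sq_norm_inner_left, hv, one_pow]
  have hu : ∀ i, ‖u i‖ = 1 := fun i => u.orthonormal.1 i
  set c : Fin n → ℝ := fun l => ∑ j : Fin k, ∑ i, ‖inner ℂ (y l) (u i)‖ ^ 2 *
    ‖inner ℂ (u i) (x (Fin.castLE hk j))‖ ^ 2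
  have hc0 : ∀ l, 0 ≤ c l := fun l => by positivity
  have hc1 : ∀ l, c l ≤ 1 := fun l => by
    calc c l ≤ ∑ j, ∑ i, ‖inner ℂ (y l) (u i)‖ ^ 2 * ‖inner ℂ (u i) (x j)‖ ^ 2 := by
          simp only [c]
          rw [← Finset.sum_image (g := Fin.castLE hk) (s := Finset.univ) (f := fun j =>
            ∑ i, ‖inner ℂ (y l) (u i)‖ ^ 2 * ‖inner ℂ (u i) (x j)‖ ^ 2)
            (Fin.castLE_injective hk).injOn]
          exact Finset.sum_le_sum_of_subset_of_nonneg (Finset.subset_univ _)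
            fun _ _ _ => by positivity
      _ = 1 := by
          rw [Finset.sum_comm]
          simp_rw [← Finset.mul_sum, hx _ (hu _), mul_one]
          rw [OrthonormalBasis.sum_sq_norm_inner_left, y.orthonormal.1 l, one_pow]
  have hsum : ∑ l, c l = k := by
    rw [Finset.sum_comm]
    have : ∀ j, ∑ l, ∑ i, ‖inner ℂ (y l) (u i)‖ ^ 2 * ‖inner ℂ (u i) (x j)‖ ^ 2 = 1 := by
      intro j
      rw [Finset.sum_comm]
      simp_rw [← Finset.sum_mul, sum_sq_norm_inner_basis_eq_one y (hu _), one_mul]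
      exact sum_sq_norm_inner_basis_eq_one u (hX.eigenvectorBasis.orthonormal.1 _)
    simp [this]
  have hfμ : ∀ i, f (hM.eigenvalues i) ≤
      ∑ l, hY.eigenvalues l * ‖inner ℂ (y l) (u i)‖ ^ 2 := fun i => by
    rw [← hY.reQuadForm_eq_sum, ← hM.reQuadForm_eigenvectorBasis]
    exact map_reQuadForm_midpoint_le hA hB hJA hJB hconv hcont (hu i)
  refine le_trans ?_ (sum_eigenvalues_mul_le_sum_eigDesc hY hc0 hc1 hk1 hk hsum)
  calc ∑ j : Fin k, eigDesc hX (Fin.castLE hk j)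
      = ∑ j : Fin k, ∑ i, f (hM.eigenvalues i) * ‖inner ℂ (u i) (x (Fin.castLE hk j))‖ ^ 2 := by
        refine Finset.sum_congr rfl fun j _ => ?_
        rw [eigDesc_eq, ← hX.reQuadForm_eigenvectorBasis, hM.reQuadForm_cfc_eq_sum]
    _ ≤ ∑ j : Fin k, ∑ i, (∑ l, hY.eigenvalues l * ‖inner ℂ (y l) (u i)‖ ^ 2) *
          ‖inner ℂ (u i) (x (Fin.castLE hk j))‖ ^ 2 := by
        gcongr with j _ i _
        exact hfμ i
    _ = ∑ l, hY.eigenvalues l * c l := by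
        simp only [c, Finset.mul_sum, Finset.sum_mul, mul_assoc]
        rw [Finset.sum_comm (s := (Finset.univ : Finset (Fin n)))]
        exact Finset.sum_congr rfl fun j _ => Finset.sum_comm
end

section
/- Let r > 1 and A, B ∈ M_n be positive semidefinite Hermitian matrices. Then for every unitarily invariant norm |||·|||, ||| ((A+B)/2)^r ||| ≤ ||| ∫_0^1 (tA+(1-t)B)^r dt |||. -/
open scoped ComplexOrder

section
open scoped Matrix.Norms.L2Operator
theorem continuous_cfc_segment {n : ℕ} (f : ℝ → ℝ) (hf : Continuous f)
    {A B : Matrix (Fin n) (Fin n) ℂ} (hA : A.IsHermitian) (hB : B.IsHermitian) :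
    Continuous fun t : ℝ => cfc f (t • A + (1 - t) • B) := by
  refine Continuous.cfc_of_mem_nhdsSet (s := Set.univ) f Filter.univ_mem (by fun_prop) ?_ hf.continuousOn
  intro t
  exact ((IsSelfAdjoint.all t).smul hA.isSelfAdjoint).add ((IsSelfAdjoint.all _).smul hB.isSelfAdjoint)
end

theorem posSemidef_intervalIntegral {n : ℕ} {R : ℝ → Matrix (Fin n) (Fin n) ℂ}
    (hR : Continuous R) (h : ∀ t ∈ Set.Icc (0 : ℝ) 1, (R t).PosSemidef) :
    (Matrix.of fun i j => ∫ t in (0 : ℝ)..1, R t i j).PosSemidef := by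
  have hc : ∀ i j, Continuous fun t => R t i j := fun i j => hR.matrix_elem i j
  rw [Matrix.posSemidef_iff_dotProduct_mulVec]
  constructor
  · ext i j
    simp only [Matrix.conjTranspose_apply, Matrix.of_apply, RCLike.star_def]
    rw [intervalIntegral.integral_of_le zero_le_one, intervalIntegral.integral_of_le zero_le_one,
      ← integral_conj, ← intervalIntegral.integral_of_le zero_le_one,
      ← intervalIntegral.integral_of_le zero_le_one]
    refine intervalIntegral.integral_congr fun t ht => ?_
    rw [Set.uIcc_of_le zero_le_one] at ht
    exact (h t ht).1.apply i j
  · intro x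
    have key : star x ⬝ᵥ (Matrix.of fun i j => ∫ t in (0 : ℝ)..1, R t i j).mulVec x =
        ∫ t in (0 : ℝ)..1, star x ⬝ᵥ (R t).mulVec x := by
      simp only [dotProduct, Matrix.mulVec, Matrix.of_apply]
      rw [intervalIntegral.integral_finsetSum fun i _ => by
        apply Continuous.intervalIntegrable; fun_prop]
      refine Finset.sum_congr rfl fun i _ => ?_
      rw [intervalIntegral.integral_const_mul,
        intervalIntegral.integral_finsetSum fun j _ => by
          apply Continuous.intervalIntegrable; fun_prop]
      simp only [intervalIntegral.integral_mul_const]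
    rw [key, intervalIntegral.integral_of_le zero_le_one]
    refine MeasureTheory.integral_nonneg_of_ae ?_
    filter_upwards [MeasureTheory.ae_restrict_mem measurableSet_Ioc] with t ht
    exact (h t (Set.Ioc_subset_Icc_self ht)).dotProduct_mulVec_nonneg x

theorem rpow_tangent_le {r : ℝ} (hr : 1 ≤ r) {a s : ℝ} (ha : 0 ≤ a) (hs : 0 ≤ s) :
    a ^ r + r * a ^ (r - 1) * (s - a) ≤ s ^ r := by
  rcases ha.eq_or_lt with rfl | ha
  · rw [Real.zero_rpow (by linarith)]
    rcases hr.eq_or_lt with rfl | hr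
    · simp
    · rw [Real.zero_rpow (by linarith)]
      simpa using Real.rpow_nonneg hs r
  · have h := one_add_mul_self_le_rpow_one_add (s := s / a - 1)
      (by linarith [div_nonneg hs ha.le]) hr
    rw [add_sub_cancel, Real.div_rpow hs ha.le, le_div_iff₀ (Real.rpow_pos_of_pos ha r)] at h
    refine le_trans (le_of_eq ?_) h
    rw [Real.rpow_sub_one ha.ne']
    field_simp

section
open scoped MatrixOrder
theorem posSemidef_cfc_rpow_sub_tangent {n : ℕ} {r : ℝ} (hr : 1 ≤ r)
    {X : Matrix (Fin n) (Fin n) ℂ} (hX : X.PosSemidef) {a : ℝ} (ha : 0 ≤ a) :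
    (cfc (fun s : ℝ => s ^ r) X -
      ((a ^ r - r * a ^ (r - 1) * a) • (1 : Matrix (Fin n) (Fin n) ℂ) +
        (r * a ^ (r - 1)) • X)).PosSemidef := by
  have hsa : IsSelfAdjoint X := hX.1.isSelfAdjoint
  rw [← Matrix.le_iff, ← Algebra.algebraMap_eq_smul_one, ← cfc_const_mul_id _ X,
    ← cfc_const_add _ _ X]
  refine cfc_mono (fun s hs => ?_) (by fun_prop) ?_
  · have := rpow_tangent_le hr ha (spectrum_nonneg_of_nonneg hX.nonneg hs)
    linarith
  · exact (Real.continuous_rpow_const (by linarith)).continuousOn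
end

section
variable {n : ℕ} {g : Matrix (Fin n) (Fin n) ℂ → ℝ}

/-- The diagonal matrix with entry `-1` at `i` and `1` elsewhere. -/
def signUnitary {n : ℕ} (i : Fin n) : Matrix.unitaryGroup (Fin n) ℂ :=
  ⟨Matrix.diagonal (Function.update 1 i (-1)), by
    rw [Matrix.mem_unitaryGroup_iff, Matrix.star_eq_conjTranspose, Matrix.diagonal_conjTranspose,
      Matrix.diagonal_mul_diagonal, ← Matrix.diagonal_one]
    congr 1
    ext j
    by_cases h : j = i
    · subst h; simp
    · simp [h]⟩

theorem norm_convex_combination_le (hg_add : ∀ X Y, g (X + Y) ≤ g X + g Y)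
    (hg_smul : ∀ (c : ℂ) X, g (c • X) = ‖c‖ * g X) {a b : ℝ} (ha : 0 ≤ a) (hb : 0 ≤ b)
    (hab : a + b = 1) {X Y : Matrix (Fin n) (Fin n) ℂ} (hXY : g Y = g X) :
    g ((a : ℂ) • X + (b : ℂ) • Y) ≤ g X := by
  refine (hg_add _ _).trans (le_of_eq ?_)
  rw [hg_smul, hg_smul, hXY, Complex.norm_of_nonneg ha, Complex.norm_of_nonneg hb, ← add_mul, hab,
    one_mul]

theorem norm_diagonal_mul_le (hg_add : ∀ X Y, g (X + Y) ≤ g X + g Y)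
    (hg_smul : ∀ (c : ℂ) X, g (c • X) = ‖c‖ * g X)
    (hg_unitary : ∀ (X : Matrix (Fin n) (Fin n) ℂ)
      (U V : Matrix.unitaryGroup (Fin n) ℂ), g ((U : Matrix (Fin n) (Fin n) ℂ) * X * V) = g X)
    {c : Fin n → ℝ} (hc : ∀ i, |c i| ≤ 1) (X : Matrix (Fin n) (Fin n) ℂ) :
    g (Matrix.diagonal (fun i => (c i : ℂ)) * X) ≤ g X := by
  suffices h : ∀ s : Finset (Fin n),
      g (Matrix.diagonal (fun i => if i ∈ s then (c i : ℂ) else 1) * X) ≤ g X by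
    simpa using h Finset.univ
  intro s
  induction s using Finset.induction_on with
  | empty => simp
  | insert i s hi ih =>
    refine le_trans ?_ ih
    set Y := Matrix.diagonal (fun i => if i ∈ s then (c i : ℂ) else 1) * X with hY
    have h1 := abs_le.1 (hc i)
    have key : Matrix.diagonal (fun j => if j ∈ insert i s then (c j : ℂ) else 1) * X =
        (((1 + c i) / 2 : ℝ) : ℂ) • Y +
          (((1 - c i) / 2 : ℝ) : ℂ) • ((signUnitary i : Matrix (Fin n) (Fin n) ℂ) * Y *
            (1 : Matrix.unitaryGroup (Fin n) ℂ)) := by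
      ext j k
      by_cases h : j = i
      · subst h
        simp [hY, signUnitary, hi]
        ring
      · simp [hY, signUnitary, h]
        split_ifs <;> ring
    rw [key]
    exact norm_convex_combination_le hg_add hg_smul (by linarith) (by linarith) (by ring) (hg_unitary _ _ _)

theorem norm_diagonal_diag_le (hg_add : ∀ X Y, g (X + Y) ≤ g X + g Y)
    (hg_smul : ∀ (c : ℂ) X, g (c • X) = ‖c‖ * g X)
    (hg_unitary : ∀ (X : Matrix (Fin n) (Fin n) ℂ)
      (U V : Matrix.unitaryGroup (Fin n) ℂ), g ((U : Matrix (Fin n) (Fin n) ℂ) * X * V) = g X)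
    (X : Matrix (Fin n) (Fin n) ℂ) :
    g (Matrix.diagonal X.diag) ≤ g X := by
  suffices h : ∀ s : Finset (Fin n),
      g (Matrix.of fun j k => if j ≠ k ∧ (j ∈ s ∨ k ∈ s) then 0 else X j k) ≤ g X by
    convert h Finset.univ using 2
    ext j k
    by_cases hjk : j = k
    · subst hjk; simp
    · simp [hjk]
  intro s
  induction s using Finset.induction_on with
  | empty => simp; rfl
  | insert i s hi ih =>
    refine le_trans ?_ ih
    set Y := Matrix.of fun j k => if j ≠ k ∧ (j ∈ s ∨ k ∈ s) then 0 else X j k with hY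
    have key : (Matrix.of fun j k => if j ≠ k ∧ (j ∈ insert i s ∨ k ∈ insert i s) then 0
        else X j k) = ((1 / 2 : ℝ) : ℂ) • Y +
          ((1 / 2 : ℝ) : ℂ) • ((signUnitary i : Matrix (Fin n) (Fin n) ℂ) * Y *
            (signUnitary i : Matrix (Fin n) (Fin n) ℂ)) := by
      ext j k
      by_cases hjk : j = k
      · subst hjk
        by_cases h : j = i
        · subst h
          simp [hY, signUnitary]
          ring
        · simp [hY, signUnitary, h]
          ring
      · by_cases h : j = i
        · subst h
          simp [hY, signUnitary, hjk, Ne.symm hjk]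
          split_ifs <;> ring
        · by_cases h' : k = i
          · subst h'
            simp [hY, signUnitary, hjk]
          · simp [hY, signUnitary, h, h', hjk]
            split_ifs <;> ring
    rw [key]
    exact norm_convex_combination_le hg_add hg_smul (by norm_num) (by norm_num) (by norm_num)
      (hg_unitary _ _ _)

theorem norm_diagonal_le_of_le_diag (hg_add : ∀ X Y, g (X + Y) ≤ g X + g Y)
    (hg_smul : ∀ (c : ℂ) X, g (c • X) = ‖c‖ * g X)
    (hg_unitary : ∀ (X : Matrix (Fin n) (Fin n) ℂ)
      (U V : Matrix.unitaryGroup (Fin n) ℂ), g ((U : Matrix (Fin n) (Fin n) ℂ) * X * V) = g X)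
    {a : Fin n → ℝ} (ha : ∀ i, 0 ≤ a i) {X : Matrix (Fin n) (Fin n) ℂ}
    (haX : ∀ i, (a i : ℂ) ≤ X i i) :
    g (Matrix.diagonal fun i => (a i : ℂ)) ≤ g X := by
  have hre : ∀ i, a i ≤ (X i i).re := fun i => (Complex.le_def.1 (haX i)).1
  have hX : ∀ i, X i i = ((X i i).re : ℂ) := fun i =>
    Complex.ext rfl (Complex.le_def.1 (haX i)).2.symm
  have key : (Matrix.diagonal fun i => (a i : ℂ)) =
      Matrix.diagonal (fun i => ((a i / (X i i).re : ℝ) : ℂ)) * Matrix.diagonal X.diag := by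
    rw [Matrix.diagonal_mul_diagonal]
    congr 1
    ext i
    rw [Matrix.diag_apply, hX i, ← Complex.ofReal_mul, Complex.ofReal_re]
    rcases ((ha i).trans (hre i)).eq_or_lt with h | h
    · have : a i = 0 := le_antisymm ((hre i).trans h.ge) (ha i)
      simp [this]
    · rw [div_mul_cancel₀ _ h.ne']
  rw [key]
  refine (norm_diagonal_mul_le hg_add hg_smul hg_unitary (fun i => ?_) _).trans
    (norm_diagonal_diag_le hg_add hg_smul hg_unitary X)
  rw [abs_of_nonneg (div_nonneg (ha i) ((ha i).trans (hre i)))]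
  exact div_le_one_of_le₀ (hre i) ((ha i).trans (hre i))
end

/-- For `r > 1`, positive semidefinite Hermitian matrices `A, B` and any unitarily
invariant norm `g` on `n×n` matrices,
`g(((A+B)/2)^r) ≤ g(∫_0^1 (tA+(1-t)B)^r dt)`, where `X^r` is defined by functional
calculus with `f(t) = t^r` and the integral is taken entrywise. -/
theorem hermite_hadamard_unitarily_invariant_norm
    {n : ℕ} (r : ℝ) (hr : 1 < r)
    (A B : Matrix (Fin n) (Fin n) ℂ) (hA : A.PosSemidef) (hB : B.PosSemidef)
    (g : Matrix (Fin n) (Fin n) ℂ → ℝ)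
    (hg_add : ∀ X Y, g (X + Y) ≤ g X + g Y)
    (hg_smul : ∀ (c : ℂ) X, g (c • X) = ‖c‖ * g X)
    (hg_pos : ∀ X, X ≠ 0 → 0 < g X)
    (hg_unitary : ∀ (X : Matrix (Fin n) (Fin n) ℂ)
      (U V : Matrix.unitaryGroup (Fin n) ℂ), g ((U : Matrix (Fin n) (Fin n) ℂ) * X * V) = g X) :
    g (cfc (fun t : ℝ => t ^ r) ((1/2 : ℝ) • (A + B))) ≤
      g (Matrix.of fun i j =>
        ∫ t in (0:ℝ)..1, (cfc (fun s : ℝ => s ^ r) (t • A + (1 - t) • B)) i j) := by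
  have hr1 : 1 ≤ r := hr.le
  set M := (1 / 2 : ℝ) • (A + B) with hMdef
  have hM : M.PosSemidef := (hA.add hB).smul (by norm_num)
  set K := Matrix.of fun i j =>
    ∫ t in (0:ℝ)..1, (cfc (fun s : ℝ => s ^ r) (t • A + (1 - t) • B)) i j with hK
  have hcont := continuous_cfc_segment (fun s : ℝ => s ^ r)
    (Real.continuous_rpow_const (by linarith)) hA.1 hB.1
  have hseg : ∀ t ∈ Set.Icc (0 : ℝ) 1, (t • A + (1 - t) • B).PosSemidef := fun t ht =>
    (hA.smul ht.1).add (hB.smul (sub_nonneg.2 ht.2))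
  have htangent : ∀ a : ℝ, 0 ≤ a → (K - ((a ^ r - r * a ^ (r - 1) * a) •
      (1 : Matrix (Fin n) (Fin n) ℂ) + (r * a ^ (r - 1)) • M)).PosSemidef := by
    intro a ha
    set b := a ^ r - r * a ^ (r - 1) * a
    set m := r * a ^ (r - 1)
    convert posSemidef_intervalIntegral (R := fun t => cfc (fun s : ℝ => s ^ r)
      (t • A + (1 - t) • B) - (b • (1 : Matrix (Fin n) (Fin n) ℂ) + m • (t • A + (1 - t) • B)))
      (by fun_prop) (fun t ht => posSemidef_cfc_rpow_sub_tangent hr1 (hseg t ht) ha) using 1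
    ext i j
    simp only [hK, hMdef, Matrix.sub_apply, Matrix.add_apply, Matrix.smul_apply, Matrix.of_apply]
    rw [intervalIntegral.integral_sub
      ((hcont.matrix_elem i j).intervalIntegrable _ _)
      (by apply Continuous.intervalIntegrable; fun_prop)]
    congr 1
    have hlin : ∀ t : ℝ, b • (1 : Matrix (Fin n) (Fin n) ℂ) i j +
        m • (t • A i j + (1 - t) • B i j) =
        (b • (1 : Matrix (Fin n) (Fin n) ℂ) i j + m • B i j) + t • (m • (A i j - B i j)) := by
      intro t
      simp only [Complex.real_smul]
      push_cast
      ring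
    simp only [hlin]
    rw [intervalIntegral.integral_add (by simp)
      (by apply Continuous.intervalIntegrable; fun_prop), intervalIntegral.integral_smul_const]
    simp
    ring
  set U := hM.isHermitian.eigenvectorUnitary
  have hspec : star (U : Matrix (Fin n) (Fin n) ℂ) * M * U =
      Matrix.diagonal fun i => (hM.isHermitian.eigenvalues i : ℂ) := by
    rw [← Unitary.conjStarAlgAut_star_apply (S := ℂ)]
    exact hM.isHermitian.conjStarAlgAut_star_eigenvectorUnitary
  have hdiag : ∀ i, ((hM.isHermitian.eigenvalues i ^ r : ℝ) : ℂ) ≤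
      (((star U : Matrix.unitaryGroup (Fin n) ℂ) : Matrix (Fin n) (Fin n) ℂ) * K * U) i i := by
    intro i
    have h := ((htangent _ (hM.eigenvalues_nonneg i)).conjTranspose_mul_mul_same
      (U : Matrix (Fin n) (Fin n) ℂ)).diag_nonneg (i := i)
    rw [← Matrix.star_eq_conjTranspose, mul_sub, sub_mul, mul_add, add_mul, mul_smul_comm,
      mul_smul_comm, smul_mul_assoc, smul_mul_assoc, hspec, mul_one, Unitary.coe_star_mul_self,
      Matrix.sub_apply, sub_nonneg] at h
    refine le_trans (le_of_eq ?_) h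
    simp
  rw [hM.isHermitian.cfc_eq, Matrix.IsHermitian.cfc, Unitary.conjStarAlgAut_apply]
  rw [← hg_unitary K (star U) U]
  refine (hg_unitary _ U (star U)).le.trans ?_
  exact norm_diagonal_le_of_le_diag hg_add hg_smul hg_unitary
    (fun i => Real.rpow_nonneg (hM.eigenvalues_nonneg i) r) hdiag
end
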